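/- Let λ₋ < 2 < λ₊, r > 0, ε > 0, a < 2 and b > 0, define Λ(s) = λ₋ + (λ₊ − λ₋)(tanh(s) + 1)/2, let X_l(λ) (for λ < 2) denote the unique real root of 3x − x³ + λ = 0 with x < −1 and X_u(λ) (for λ > −2) the unique real root with x > 1, and set M₊ = a + b(X_u(λ₊) − X_l(λ₋)). Suppose M₊ > 2. If (x, y) : ℝ → ℝ² is differentiable with x′(t) = 3x(t) − x(t)³ + Λ(rt) and ε y′(t) = 3y(t) − y(t)³ + a + b(x(t) − X_l(λ₋)) for all t, and (x(t), y(t)) → (X_l(λ₋), X_l(a)) as t → −∞, then y(t) → X_u(M₊) as t → +∞ (downstream B-tipping), for every ε > 0. -/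

import Mathlib

open Filter

theorem Real.tendsto_tanh_atTop_one : Tendsto Real.tanh atTop (nhds 1) := by
  have h0 : Tendsto (fun t : ℝ => Real.exp (-2 * t)) atTop (nhds 0) :=
    Real.tendsto_exp_atBot.comp (tendsto_id.const_mul_atTop_of_neg (by norm_num))
  have h1 := (h0.const_sub 1).div (h0.const_add 1) (by norm_num)
  have heq : Real.tanh = fun t : ℝ => (1 - Real.exp (-2 * t)) / (1 + Real.exp (-2 * t)) := by
    funext t
    have h2 : Real.exp (-2 * t) = Real.exp (-t) * Real.exp (-t) := by
      rw [← Real.exp_add]; ring_nf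
    have h3 : Real.exp t * Real.exp (-t) = 1 := by rw [← Real.exp_add]; simp
    have ht := Real.exp_pos t
    have hnt := Real.exp_pos (-t)
    rw [Real.tanh_eq_sinh_div_cosh, Real.sinh_eq, Real.cosh_eq, h2,
      div_eq_div_iff (by positivity) (by positivity)]
    linear_combination Real.exp (-t) * h3
  rw [heq]
  have hval : ((1 : ℝ) - 0) / (1 + 0) = 1 := by norm_num
  rw [hval] at h1
  exact h1

/-- A nonnegative function obeying `V' ≤ -α V + g` with `α > 0` and `g → 0` tends to `0`. -/
theorem tendsto_zero_of_deriv_le_neg_mul_add {V g : ℝ → ℝ} {α : ℝ} (hα : 0 < α)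
    (hV : Differentiable ℝ V) (hV0 : ∀ t, 0 ≤ V t)
    (hd : ∀ t, deriv V t ≤ -α * V t + g t) (hg : Tendsto g atTop (nhds 0)) :
    Tendsto V atTop (nhds 0) := by
  refine tendsto_order.2 ⟨fun l hl => .of_forall fun t => hl.trans_le (hV0 t), fun η hη => ?_⟩
  obtain ⟨T, hT⟩ := eventually_atTop.1 (hg.eventually (gt_mem_nhds (by positivity :
    (0 : ℝ) < α * (η / 2))))
  have hder : ∀ t, HasDerivAt (fun t => (V t - η / 2) * Real.exp (α * t))
      (deriv V t * Real.exp (α * t) + (V t - η / 2) * (Real.exp (α * t) * α)) t := fun t => by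
    have h := ((hasDerivAt_id t).const_mul α).exp
    simp only [id, mul_one] at h
    exact ((hV t).hasDerivAt.sub_const _).mul h
  have hanti : AntitoneOn (fun t => (V t - η / 2) * Real.exp (α * t)) (Set.Ici T) := by
    refine antitoneOn_of_deriv_nonpos (convex_Ici T)
      (fun t _ => (hder t).continuousAt.continuousWithinAt)
      (fun t _ => (hder t).differentiableAt.differentiableWithinAt) fun t ht => ?_
    rw [interior_Ici] at ht
    rw [(hder t).deriv]
    nlinarith [hd t, hT t (le_of_lt ht), Real.exp_pos (α * t)]
  have hexp : Tendsto (fun t : ℝ => (η / 2) * Real.exp (α * t)) atTop atTop :=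
    (Real.tendsto_exp_atTop.comp (tendsto_id.const_mul_atTop hα)).const_mul_atTop (by positivity)
  filter_upwards [eventually_ge_atTop T,
    hexp.eventually_gt_atTop ((V T - η / 2) * Real.exp (α * T))] with t ht hlt
  have hle : (V t - η / 2) * Real.exp (α * t) ≤ (V T - η / 2) * Real.exp (α * T) :=
    hanti Set.self_mem_Ici ht ht
  have := lt_of_mul_lt_mul_right (hle.trans_lt hlt) (Real.exp_pos (α * t)).le
  linarith

/-- If the forcing of `c z' = 3 * z - z ^ 3 + F` tends to a limit above the fold value `2`, every
solution tends to the unique equilibrium of the limiting equation. -/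
theorem tendsto_root_of_cubic_ode {c L X : ℝ} (hc : 0 < c) (hL : 2 < L) (hX : 1 < X)
    (hroot : 3 * X - X ^ 3 + L = 0) {z F : ℝ → ℝ} (hz : Differentiable ℝ z)
    (hode : ∀ t, c * deriv z t = 3 * z t - (z t) ^ 3 + F t)
    (hF : Tendsto F atTop (nhds L)) : Tendsto z atTop (nhds X) := by
  have hX2 : 2 < X := by
    by_contra! h
    nlinarith [mul_nonneg (sq_nonneg (X + 1)) (sub_nonneg.2 h)]
  obtain ⟨k, hk⟩ : ∃ k, k = 3 / 4 * X ^ 2 - 3 := ⟨_, rfl⟩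
  have hk0 : 0 < k := by nlinarith
  have hder : ∀ t, HasDerivAt (fun t => (z t - X) ^ 2) (2 * (z t - X) * deriv z t) t := fun t => by
    simpa using ((hz t).hasDerivAt.sub_const X).fun_pow 2
  have hlim : Tendsto (fun t => (F t - L) ^ 2 / (k * c)) atTop (nhds 0) := by
    simpa using ((hF.sub_const L).pow 2).div_const (k * c)
  have hsq : Tendsto (fun t => (z t - X) ^ 2) atTop (nhds 0) := by
    refine tendsto_zero_of_deriv_le_neg_mul_add (div_pos hk0 hc)
      (fun t => (hder t).differentiableAt) (fun t => sq_nonneg _) (fun t => ?_) hlim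
    rw [(hder t).deriv]
    have hfactor : c * deriv z t
        = -(z t - X) * ((z t + X / 2) ^ 2 + k) + (F t - L) := by
      rw [hode t, hk]
      linear_combination hroot
    have hyoung : 2 * (z t - X) * (F t - L) ≤ k * (z t - X) ^ 2 + (F t - L) ^ 2 / k := by
      have h := div_nonneg (sq_nonneg (k * (z t - X) - (F t - L))) hk0.le
      have h' : (k * (z t - X) - (F t - L)) ^ 2 / k
          = k * (z t - X) ^ 2 + (F t - L) ^ 2 / k - 2 * (z t - X) * (F t - L) := by
        field_simp
        ring
      linarith
    have hmain : c * (2 * (z t - X) * deriv z t) ≤ -k * (z t - X) ^ 2 + (F t - L) ^ 2 / k := by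
      have h : c * (2 * (z t - X) * deriv z t) = 2 * (z t - X) * (F t - L)
          - 2 * k * (z t - X) ^ 2 - 2 * ((z t - X) * (z t + X / 2)) ^ 2 := by
        linear_combination 2 * (z t - X) * hfactor
      nlinarith [sq_nonneg ((z t - X) * (z t + X / 2))]
    have hdiv : -(k / c) * (z t - X) ^ 2 + (F t - L) ^ 2 / (k * c)
        = (-k * (z t - X) ^ 2 + (F t - L) ^ 2 / k) / c := by
      field_simp
    rw [hdiv, le_div_iff₀ hc]
    linarith
  have habs := hsq.sqrt
  simp only [Real.sqrt_sq_eq_abs, Real.sqrt_zero] at habs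
  exact tendsto_sub_nhds_zero_iff.1 ((tendsto_zero_iff_abs_tendsto_zero _).2 habs)

/-- Downstream B-tipping for linear coupling: if the future limit
`M₊ = a + b(X_u(λ₊) − X_l(λ₋))` of the effective downstream forcing exceeds the fold
value `2`, then for every timescale separation `ε > 0` the downstream pullback
trajectory converges to the tipped state `X_u(M₊)`. -/
theorem stmt_15 (lamm lamp : ℝ) (hm : lamm < 2) (hp : 2 < lamp)
    (r : ℝ) (hr : 0 < r) (eps : ℝ) (heps : 0 < eps)
    (a b : ℝ) (ha : a < 2) (hb : 0 < b)
    (Xlm : ℝ) (hXlm : Xlm < -1) (hXlmroot : 3 * Xlm - Xlm ^ 3 + lamm = 0)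
    (Xla : ℝ) (hXla : Xla < -1) (hXlaroot : 3 * Xla - Xla ^ 3 + a = 0)
    (Xup : ℝ) (hXup : Xup > 1) (hXuproot : 3 * Xup - Xup ^ 3 + lamp = 0)
    (hMp : a + b * (Xup - Xlm) > 2)
    (XuM : ℝ) (hXuM : XuM > 1)
    (hXuMroot : 3 * XuM - XuM ^ 3 + (a + b * (Xup - Xlm)) = 0)
    (x y : ℝ → ℝ) (hdx : Differentiable ℝ x) (hdy : Differentiable ℝ y)
    (hodex : ∀ t : ℝ, deriv x t =
      3 * x t - (x t) ^ 3 + (lamm + (lamp - lamm) * (Real.tanh (r * t) + 1) / 2))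
    (hodey : ∀ t : ℝ, eps * deriv y t = 3 * y t - (y t) ^ 3 + (a + b * (x t - Xlm)))
    (hpastx : Tendsto x atBot (nhds Xlm))
    (hpasty : Tendsto y atBot (nhds Xla)) :
    Tendsto y atTop (nhds XuM) := by
  have hforcing : Tendsto
      (fun t => lamm + (lamp - lamm) * (Real.tanh (r * t) + 1) / 2) atTop (nhds lamp) := by
    have h := (Real.tendsto_tanh_atTop_one.comp (tendsto_id.const_mul_atTop hr)).add_const 1
    have h' := ((h.const_mul (lamp - lamm)).div_const 2).const_add lamm
    have hval : lamm + (lamp - lamm) * (1 + 1) / 2 = lamp := by ring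
    rw [hval] at h'
    exact h'
  have hx : Tendsto x atTop (nhds Xup) :=
    tendsto_root_of_cubic_ode one_pos hp hXup hXuproot hdx
      (fun t => by rw [one_mul, hodex t]) hforcing
  exact tendsto_root_of_cubic_ode heps hMp hXuM hXuMroot hdy hodey
    (((hx.sub_const Xlm).const_mul b).const_add a)
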